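/- arXiv:1811.00601 — 8 statements merged into one kernel-verified Lean document; each statement's English description precedes it below -/
import Mathlib

section
/- Let E be a real vector space, k ≥ 1, and λ an equivalence relation (Setoid) on Fin k. Then there is a linear isomorphism of the quotient module (Fin k → E) ⧸ D_λ with the product, over all equivalence classes b of λ, of the quotient modules ({i : Fin k // ⟦i⟧ = b} → E) ⧸ Δ_b, where Δ_b is the subspace of constant functions on the class b. (In the notation of the paper: D_{0λ} = E^k/D_λ ≅ E^{k_1}/E × ⋯ × E^{k_n}/E where k_1,…,k_n are the block sizes of λ.) -/
/-- The diagonal subspace `D_λ` of `Fin k → E` associated to a setoid (set partition)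
`λ` on `Fin k`: all `p` with `p i = p j` whenever `i ∼_λ j`. -/
def diagonal (E : Type*) [AddCommGroup E] [Module ℝ E] {k : ℕ} (s : Setoid (Fin k)) :
    Submodule ℝ (Fin k → E) where
  carrier := {p | ∀ i j, s i j → p i = p j}
  add_mem' := by
    intro p q hp hq i j hij
    simp only [Pi.add_apply, hp i j hij, hq i j hij]
  zero_mem' := by intro i j _; rfl
  smul_mem' := by
    intro c p hp i j hij
    simp only [Pi.smul_apply, hp i j hij]

/-- The subspace of constant functions `ι → E`. -/
def constants (E : Type*) [AddCommGroup E] [Module ℝ E] (ι : Type*) :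
    Submodule ℝ (ι → E) where
  carrier := {p | ∀ i j, p i = p j}
  add_mem' := by
    intro p q hp hq i j
    simp only [Pi.add_apply, hp i j, hq i j]
  zero_mem' := by intro i j; rfl
  smul_mem' := by
    intro c p hp i j
    simp only [Pi.smul_apply, hp i j]

/-- Restriction of functions to the blocks of a setoid, modulo constants on each block. -/
def toBlockQuotients (E : Type*) [AddCommGroup E] [Module ℝ E] {k : ℕ} (s : Setoid (Fin k)) :
    (Fin k → E) →ₗ[ℝ] (b : Quotient s) →
      (({i : Fin k // Quotient.mk s i = b} → E) ⧸
        constants E {i : Fin k // Quotient.mk s i = b}) :=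
  LinearMap.pi fun b =>
    (constants E {i : Fin k // Quotient.mk s i = b}).mkQ ∘ₗ LinearMap.funLeft ℝ E Subtype.val

theorem toBlockQuotients_surjective (E : Type*) [AddCommGroup E] [Module ℝ E] {k : ℕ}
    (s : Setoid (Fin k)) : Function.Surjective (toBlockQuotients E s) := by
  intro y
  choose q hq using fun b => Submodule.mkQ_surjective _ (y b)
  refine ⟨fun i => q (Quotient.mk s i) ⟨i, rfl⟩, funext fun b => ?_⟩
  rw [← hq b]
  refine congrArg (Submodule.mkQ _) (funext ?_)
  rintro ⟨i, rfl⟩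
  rfl

theorem ker_toBlockQuotients (E : Type*) [AddCommGroup E] [Module ℝ E] {k : ℕ}
    (s : Setoid (Fin k)) : LinearMap.ker (toBlockQuotients E s) = diagonal E s := by
  ext p
  rw [LinearMap.mem_ker, funext_iff]
  change (∀ b, Submodule.Quotient.mk _ = 0) ↔ _
  simp only [Submodule.Quotient.mk_eq_zero]
  constructor
  · intro h i j hij
    exact h (Quotient.mk s j) ⟨i, Quotient.sound hij⟩ ⟨j, rfl⟩
  · rintro h b ⟨i, hi⟩ ⟨j, hj⟩
    exact h i j (Quotient.exact (hi.trans hj.symm))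

/-- `(Fin k → E) ⧸ D_λ` is linearly isomorphic to the product, over the blocks `b` of `λ`,
of the quotients `({i // ⟦i⟧ = b} → E) ⧸ Δ_b` by the constants on each block:
`E^k/D_λ ≅ E^{k_1}/E × ⋯ × E^{k_n}/E`. -/
theorem quotient_diagonal_equiv_prod {E : Type*} [AddCommGroup E] [Module ℝ E]
    {k : ℕ} (hk : 1 ≤ k) (lam : Setoid (Fin k)) :
    Nonempty (((Fin k → E) ⧸ diagonal E lam) ≃ₗ[ℝ]
      ((b : Quotient lam) →
        (({i : Fin k // Quotient.mk lam i = b} → E) ⧸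
          constants E {i : Fin k // Quotient.mk lam i = b}))) := by
  exact ⟨(Submodule.quotEquivOfEq _ _ (ker_toBlockQuotients E lam).symm).trans
    ((toBlockQuotients E lam).quotKerEquivOfSurjective (toBlockQuotients_surjective E lam))⟩
end

section
/- Let k ≥ 1 and let λ be an equivalence relation (Setoid) on Fin k. Then P_λ is a normal subgroup of Σ_λ, and the quotient group Sym_λ := Σ_λ / P_λ is isomorphic to the product of symmetric groups ∏_{j=1}^{k} Perm (Fin n_j), where n_j is the number of equivalence classes of λ having exactly j elements. -/
/-- `Σ_λ`: the subgroup of permutations of `Fin k` preserving the setoid `λ`,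
i.e. `σ` with `i ∼_λ j ↔ σ i ∼_λ σ j` for all `i, j`. -/
def sigmaGrp {k : ℕ} (s : Setoid (Fin k)) : Subgroup (Equiv.Perm (Fin k)) where
  carrier := {σ | ∀ i j, s i j ↔ s (σ i) (σ j)}
  one_mem' := fun _ _ => Iff.rfl
  mul_mem' := by
    intro a b ha hb i j
    exact (hb i j).trans (ha (b i) (b j))
  inv_mem' := by
    intro a ha i j
    simpa using (ha (a⁻¹ i) (a⁻¹ j)).symm

/-- `P_λ`: the subgroup of permutations `σ` of `Fin k` with `σ i ∼_λ i` for all `i`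
(the pointwise stabilizer of the diagonal `D_λ`). -/
def ptwGrp {k : ℕ} (s : Setoid (Fin k)) : Subgroup (Equiv.Perm (Fin k)) where
  carrier := {σ | ∀ i, s (σ i) i}
  one_mem' := fun i => s.refl i
  mul_mem' := by
    intro a b ha hb i
    exact s.trans (ha (b i)) (hb i)
  inv_mem' := by
    intro a ha i
    simpa using s.symm (ha (a⁻¹ i))

/-- The action of `Σ_λ` on the set of `λ`-classes. -/
def sigmaGrpToPermQuotient {k : ℕ} (s : Setoid (Fin k)) :
    ↥(sigmaGrp s) →* Equiv.Perm (Quotient s) where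
  toFun σ := Quotient.congr σ.1 σ.2
  map_one' := by
    ext b
    induction b using Quotient.inductionOn with | _ i => rfl
  map_mul' σ τ := by
    ext b
    induction b using Quotient.inductionOn with | _ i => rfl

theorem sigmaGrpToPermQuotient_mk {k : ℕ} (s : Setoid (Fin k)) (σ : ↥(sigmaGrp s)) (i : Fin k) :
    sigmaGrpToPermQuotient s σ (Quotient.mk s i) = Quotient.mk s (σ.1 i) :=
  rfl

theorem ker_sigmaGrpToPermQuotient {k : ℕ} (s : Setoid (Fin k)) :
    (sigmaGrpToPermQuotient s).ker = (ptwGrp s).subgroupOf (sigmaGrp s) := by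
  ext σ
  rw [MonoidHom.mem_ker, Subgroup.mem_subgroupOf]
  constructor
  · intro h i
    exact Quotient.exact ((sigmaGrpToPermQuotient_mk s σ i).symm.trans (by rw [h]; rfl))
  · intro h
    ext b
    induction b using Quotient.inductionOn with | _ i => exact Quotient.sound (h i)

theorem card_fiber_sigmaGrpToPermQuotient {k : ℕ} (s : Setoid (Fin k)) (σ : ↥(sigmaGrp s))
    (b : Quotient s) :
    Nat.card {i : Fin k // Quotient.mk s i = sigmaGrpToPermQuotient s σ b} =
      Nat.card {i : Fin k // Quotient.mk s i = b} := by
  refine (Nat.card_congr (σ.1.subtypeEquiv fun i => ?_)).symm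
  rw [← sigmaGrpToPermQuotient_mk, EmbeddingLike.apply_eq_iff_eq]

/-- A permutation of the classes preserving their cardinalities lifts to `Σ_λ`. -/
theorem exists_sigmaGrpToPermQuotient_eq {k : ℕ} (s : Setoid (Fin k))
    (τ : Equiv.Perm (Quotient s))
    (hτ : ∀ b, Nat.card {i : Fin k // Quotient.mk s i = τ b} =
      Nat.card {i : Fin k // Quotient.mk s i = b}) :
    ∃ σ, sigmaGrpToPermQuotient s σ = τ := by
  let e (b : Quotient s) : {i : Fin k // Quotient.mk s i = b} ≃
      {i : Fin k // Quotient.mk s i = τ b} := (Finite.card_eq.1 (hτ b).symm).some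
  let σ : Equiv.Perm (Fin k) := (Equiv.sigmaFiberEquiv (Quotient.mk s)).symm.trans
    ((Equiv.sigmaCongr τ e).trans (Equiv.sigmaFiberEquiv (Quotient.mk s)))
  have hσ (i : Fin k) : Quotient.mk s (σ i) = τ (Quotient.mk s i) :=
    (e (Quotient.mk s i) ⟨i, rfl⟩).2
  refine ⟨⟨σ, fun i j => ?_⟩, ?_⟩
  · rw [← Quotient.eq, ← Quotient.eq, hσ, hσ, EmbeddingLike.apply_eq_iff_eq]
  · ext b
    induction b using Quotient.inductionOn with | _ i => exact hσ i

/-- Permutations of the parts of a partition of `α` glue to a permutation of `α`. -/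
theorem exists_perm_eq_on_parts {α ι : Type*} (p : ι → α → Prop) (hp : ∀ a, ∃! i, p i a)
    (e : ∀ i, Equiv.Perm {a // p i a}) :
    ∃ τ : Equiv.Perm α, ∀ i a (ha : p i a), τ a = e i ⟨a, ha⟩ := by
  choose c hc huniq using hp
  let f : α ≃ Σ i, {a // p i a} :=
    { toFun := fun a => ⟨c a, a, hc a⟩
      invFun := fun x => x.2.1
      left_inv := fun _ => rfl
      right_inv := by
        rintro ⟨i, a, ha⟩
        obtain rfl := huniq a i ha
        rfl }
  refine ⟨f.trans ((Equiv.sigmaCongrRight e).trans f.symm), fun i a ha => ?_⟩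
  obtain rfl := huniq a i ha
  rfl

/-- The action of `Σ_λ` on the classes of each cardinality `1, …, k`. -/
def sigmaGrpToPiPerm {k : ℕ} (s : Setoid (Fin k)) :
    ↥(sigmaGrp s) →* ((j : Fin k) → Equiv.Perm
      {b : Quotient s // Nat.card {i : Fin k // Quotient.mk s i = b} = j.val + 1}) where
  toFun σ j := (sigmaGrpToPermQuotient s σ).subtypePerm fun b => by
    rw [card_fiber_sigmaGrpToPermQuotient]
  map_one' := by
    ext j b : 3
    simp
  map_mul' σ τ := by
    ext j b : 3
    simp only [map_mul]
    rfl

theorem sigmaGrpToPiPerm_apply_coe {k : ℕ} (s : Setoid (Fin k)) (σ : ↥(sigmaGrp s)) (j : Fin k)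
    (b : {b : Quotient s // Nat.card {i : Fin k // Quotient.mk s i = b} = j.val + 1}) :
    (sigmaGrpToPiPerm s σ j b : Quotient s) = sigmaGrpToPermQuotient s σ b :=
  rfl

theorem existsUnique_card_fiber_eq {k : ℕ} (s : Setoid (Fin k)) (b : Quotient s) :
    ∃! j : Fin k, Nat.card {i : Fin k // Quotient.mk s i = b} = j.val + 1 := by
  have hpos : 0 < Nat.card {i : Fin k // Quotient.mk s i = b} := by
    obtain ⟨i, hi⟩ := Quotient.exists_rep b
    have : Nonempty {i : Fin k // Quotient.mk s i = b} := ⟨⟨i, hi⟩⟩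
    exact Nat.card_pos
  have hle : Nat.card {i : Fin k // Quotient.mk s i = b} ≤ k := by
    simpa using Finite.card_subtype_le fun i : Fin k => Quotient.mk s i = b
  refine ⟨⟨Nat.card {i : Fin k // Quotient.mk s i = b} - 1, by omega⟩, by simp; omega, ?_⟩
  intro j hj
  ext
  simp only
  omega

theorem ker_sigmaGrpToPiPerm {k : ℕ} (s : Setoid (Fin k)) :
    (sigmaGrpToPiPerm s).ker = (ptwGrp s).subgroupOf (sigmaGrp s) := by
  rw [← ker_sigmaGrpToPermQuotient]
  ext σ
  rw [MonoidHom.mem_ker, MonoidHom.mem_ker]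
  constructor
  · intro h
    ext b
    obtain ⟨j, hj, -⟩ := existsUnique_card_fiber_eq s b
    rw [← sigmaGrpToPiPerm_apply_coe s σ j ⟨b, hj⟩, h]
    rfl
  · intro h
    ext j b : 3
    rw [sigmaGrpToPiPerm_apply_coe, h]
    rfl

theorem sigmaGrpToPiPerm_surjective {k : ℕ} (s : Setoid (Fin k)) :
    Function.Surjective (sigmaGrpToPiPerm s) := by
  intro e
  obtain ⟨τ, hτ⟩ := exists_perm_eq_on_parts _ (existsUnique_card_fiber_eq s) e
  obtain ⟨σ, rfl⟩ := exists_sigmaGrpToPermQuotient_eq s τ fun b => by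
    obtain ⟨j, hj, -⟩ := existsUnique_card_fiber_eq s b
    rw [hτ j b hj, hj, (e j ⟨b, hj⟩).2]
  refine ⟨σ, ?_⟩
  ext j b : 3
  exact hτ j b b.2

/-- `P_λ` is normal in `Σ_λ`, and `Sym_λ = Σ_λ / P_λ` is isomorphic to the product
`∏_{j=1}^k Perm (Fin n_j)`, where `n_j` is the number of `λ`-classes of cardinality `j`. -/
theorem symGrp_iso_prod_perm (k : ℕ) (hk : 1 ≤ k) (lam : Setoid (Fin k)) :
    ((ptwGrp lam).subgroupOf (sigmaGrp lam)).Normal ∧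
      ∀ [_h : ((ptwGrp lam).subgroupOf (sigmaGrp lam)).Normal],
        Nonempty ((↥(sigmaGrp lam) ⧸ (ptwGrp lam).subgroupOf (sigmaGrp lam)) ≃*
          ((j : Fin k) → Equiv.Perm (Fin (Nat.card
            {b : Quotient lam // Nat.card {i : Fin k // Quotient.mk lam i = b} = j.val + 1})))) := by
  refine ⟨ker_sigmaGrpToPermQuotient lam ▸ inferInstance, fun {_} => ⟨?_⟩⟩
  exact (QuotientGroup.quotientMulEquivOfEq (ker_sigmaGrpToPiPerm lam).symm).trans
    ((QuotientGroup.quotientKerEquivOfSurjective _ (sigmaGrpToPiPerm_surjective lam)).trans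
      (MulEquiv.piCongrRight fun _ => (Finite.equivFin _).permCongrHom))
end

section
/- There exist equivalence relations (Setoids) λ, ν, ν' on Fin 5 such that: λ has classes {0},{1},{2},{3,4}; ν has classes {0,1,2},{3,4}; ν' has classes {0,1},{2,3,4}; λ ≤ ν and λ ≤ ν' in the refinement order; ν and ν' have the same multiset of class sizes {2,3}; yet there is no permutation σ of Fin 5 with σ • λ = λ and σ • ν = ν'. (Hence for k = 5 the Σ_k-orbits of length-2 chains of set partitions are not in bijection with length-2 chains of integer partitions: the refinements 1+1+1+2 = (1+1+1)+2 and 1+1+1+2 = (1+1)+(1+2) of 2+3 are inequivalent.) -/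
/-- The action of a permutation `σ` of `Fin k` on setoids: `(σ • λ) i j ↔ λ (σ⁻¹ i) (σ⁻¹ j)`. -/
def permSetoid {k : ℕ} (σ : Equiv.Perm (Fin k)) (s : Setoid (Fin k)) : Setoid (Fin k) where
  r i j := s (σ⁻¹ i) (σ⁻¹ j)
  iseqv := ⟨fun _ => s.refl _, fun h => s.symm h, fun h h' => s.trans h h'⟩

/-- The type of a set partition: the multiset of cardinalities of its equivalence classes. -/
noncomputable def classSizes {k : ℕ} (s : Setoid (Fin k)) : Multiset ℕ := by
  classical
  exact (Finset.univ : Finset (Quotient s)).val.map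
    fun b => Nat.card {i : Fin k // Quotient.mk s i = b}

/-- Setoids that correspond under a permutation of the points have the same class sizes. -/
theorem classSizes_eq_of_equiv {k : ℕ} {s t : Setoid (Fin k)} (e : Equiv.Perm (Fin k))
    (h : ∀ i j, s i j ↔ t (e i) (e j)) : classSizes s = classSizes t := by
  classical
  let q : Quotient s ≃ Quotient t := Quotient.congr e h
  have hcard (b : Quotient s) : Nat.card {i : Fin k // Quotient.mk s i = b} =
      Nat.card {i : Fin k // Quotient.mk t i = q b} := by
    refine Nat.card_congr (e.subtypeEquiv fun i => ?_)
    exact q.injective.eq_iff.symm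
  unfold classSizes
  rw [← Finset.map_univ_equiv q, Finset.map_val, Multiset.map_map]
  exact Multiset.map_congr rfl fun b _ => hcard b

/-- For `k = 5` there are set partitions `λ` (classes `{0},{1},{2},{3,4}`),
`ν` (classes `{0,1,2},{3,4}`) and `ν'` (classes `{0,1},{2,3,4}`) with `λ ≤ ν`, `λ ≤ ν'`,
`ν` and `ν'` of the same type `{2,3}`, but no permutation `σ` with `σ • λ = λ` and
`σ • ν = ν'`: the two refinements `1+1+1+2 = (1+1+1)+2 = (1+1)+(1+2)` of `2+3` are
inequivalent chains. -/
theorem exists_inequivalent_chains :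
    ∃ lam nu nu' : Setoid (Fin 5),
      (∀ i j : Fin 5, lam i j ↔ (i = j ∨ (3 ≤ i.val ∧ 3 ≤ j.val))) ∧
      (∀ i j : Fin 5, nu i j ↔ ((i.val ≤ 2 ∧ j.val ≤ 2) ∨ (3 ≤ i.val ∧ 3 ≤ j.val))) ∧
      (∀ i j : Fin 5, nu' i j ↔ ((i.val ≤ 1 ∧ j.val ≤ 1) ∨ (2 ≤ i.val ∧ 2 ≤ j.val))) ∧
      lam ≤ nu ∧ lam ≤ nu' ∧
      classSizes nu = classSizes nu' ∧
      ¬ ∃ σ : Equiv.Perm (Fin 5), permSetoid σ lam = lam ∧ permSetoid σ nu = nu' := by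
  let lam : Setoid (Fin 5) :=
    { r := fun i j => i = j ∨ (3 ≤ i.val ∧ 3 ≤ j.val)
      iseqv := ⟨by grind, by grind, by grind⟩ }
  let nu : Setoid (Fin 5) :=
    { r := fun i j => (i.val ≤ 2 ∧ j.val ≤ 2) ∨ (3 ≤ i.val ∧ 3 ≤ j.val)
      iseqv := ⟨by grind, by grind, by grind⟩ }
  let nu' : Setoid (Fin 5) :=
    { r := fun i j => (i.val ≤ 1 ∧ j.val ≤ 1) ∨ (2 ≤ i.val ∧ 2 ≤ j.val)
      iseqv := ⟨by grind, by grind, by grind⟩ }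
  have hlam (i j : Fin 5) : lam i j ↔ (i = j ∨ (3 ≤ i.val ∧ 3 ≤ j.val)) := Iff.rfl
  have hnu (i j : Fin 5) :
      nu i j ↔ ((i.val ≤ 2 ∧ j.val ≤ 2) ∨ (3 ≤ i.val ∧ 3 ≤ j.val)) := Iff.rfl
  have hnu' (i j : Fin 5) :
      nu' i j ↔ ((i.val ≤ 1 ∧ j.val ≤ 1) ∨ (2 ≤ i.val ∧ 2 ≤ j.val)) := Iff.rfl
  refine ⟨lam, nu, nu', hlam, hnu, hnu', ?_, ?_, ?_, ?_⟩
  · intro i j h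
    rw [hlam] at h
    rw [hnu]
    grind
  · intro i j h
    rw [hlam] at h
    rw [hnu']
    grind
  · refine classSizes_eq_of_equiv Fin.revPerm fun i j => ?_
    rw [hnu, hnu', Fin.revPerm_apply, Fin.revPerm_apply, Fin.val_rev, Fin.val_rev]
    omega
  · rintro ⟨σ, h₁, h₂⟩
    have h34 : lam (σ⁻¹ 3) (σ⁻¹ 4) := by
      change permSetoid σ lam 3 4
      rw [h₁, hlam]
      decide
    have h23 : nu (σ⁻¹ 2) (σ⁻¹ 3) := by
      change permSetoid σ nu 2 3
      rw [h₂, hnu']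
      decide
    have ne34 : σ⁻¹ 3 ≠ σ⁻¹ 4 := σ⁻¹.injective.ne (by decide)
    have ne23 : σ⁻¹ 2 ≠ σ⁻¹ 3 := σ⁻¹.injective.ne (by decide)
    have ne24 : σ⁻¹ 2 ≠ σ⁻¹ 4 := σ⁻¹.injective.ne (by decide)
    rw [hlam] at h34
    rw [hnu] at h23
    omega
end

section
/- Let E be a real vector space, k ≥ 2, and p : Fin k → E injective. Suppose σ is a permutation of Fin k, a is a positive real number, and c ∈ E are such that p (σ i) = a • p i + c for all i ∈ Fin k. Then a = 1, c = 0 and σ is the identity permutation. (This is the freeness of the action of Σ_k, combined with scalings and translations, on ordered configurations of k pairwise distinct points.) -/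
theorem sub_perm_pow_eq_pow_smul_sub {ι E : Type*} [AddCommGroup E] [Module ℝ E]
    {p : ι → E} {σ : Equiv.Perm ι} {a : ℝ} {c : E}
    (h : ∀ i, p (σ i) = a • p i + c) (n : ℕ) (i j : ι) :
    p ((σ ^ n) i) - p ((σ ^ n) j) = a ^ n • (p i - p j) := by
  induction n with
  | zero => simp
  | succ n ih =>
    rw [pow_succ', Equiv.Perm.mul_apply, Equiv.Perm.mul_apply, h, h, add_sub_add_right_eq_sub,
      ← smul_sub, ih, smul_smul, ← pow_succ']

theorem perm_pow_eq_add_nsmul {ι E : Type*} [AddCommGroup E] {p : ι → E}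
    {σ : Equiv.Perm ι} {c : E} (h : ∀ i, p (σ i) = p i + c) (n : ℕ) (i : ι) :
    p ((σ ^ n) i) = p i + n • c := by
  induction n with
  | zero => simp
  | succ n ih => rw [pow_succ', Equiv.Perm.mul_apply, h, ih, succ_nsmul, add_assoc]

/-- If an injective configuration `p : Fin k → E` (`k ≥ 2`) of points in a real vector space
satisfies `p (σ i) = a • p i + c` for a permutation `σ`, a scalar `a > 0` and `c ∈ E`, then
`a = 1`, `c = 0` and `σ = 1`: the action of the symmetric group combined with dilations and
translations is free on ordered configurations of pairwise distinct points. -/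
theorem perm_dilation_translation_free {E : Type*} [AddCommGroup E] [Module ℝ E]
    {k : ℕ} (hk : 2 ≤ k) (p : Fin k → E) (hp : Function.Injective p)
    (σ : Equiv.Perm (Fin k)) (a : ℝ) (ha : 0 < a) (c : E)
    (h : ∀ i, p (σ i) = a • p i + c) :
    a = 1 ∧ c = 0 ∧ σ = 1 := by
  have : Nontrivial (Fin k) := Fin.nontrivial_iff_two_le.2 hk
  obtain ⟨i, j, hij⟩ := exists_pair_ne (Fin k)
  have hn : orderOf σ ≠ 0 := (orderOf_pos σ).ne'
  have hpow : a ^ orderOf σ = 1 := by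
    have hsub := sub_perm_pow_eq_pow_smul_sub h (orderOf σ) i j
    rw [pow_orderOf_eq_one, Equiv.Perm.one_apply, Equiv.Perm.one_apply] at hsub
    exact smul_left_injective ℝ (sub_ne_zero.2 (hp.ne hij)) (by simpa using hsub.symm)
  obtain rfl : a = 1 := (pow_eq_one_iff_of_nonneg ha.le hn).1 hpow
  simp only [one_smul] at h
  have hnc : (orderOf σ : ℝ) • c = 0 := by
    simpa [pow_orderOf_eq_one, Nat.cast_smul_eq_nsmul] using perm_pow_eq_add_nsmul h (orderOf σ) i
  obtain rfl : c = 0 := (smul_eq_zero.1 hnc).resolve_left (Nat.cast_ne_zero.2 hn)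
  exact ⟨rfl, rfl, Equiv.ext fun l => hp (by simpa using h l)⟩
end

section
/- Let V be a finite-dimensional real normed vector space and let W_1, …, W_m be finitely many linear subspaces of V, each satisfying finrank W_i ≤ finrank V − 3. Then the complement V \ (W_1 ∪ ⋯ ∪ W_m), with the subspace topology, is nonempty, path-connected and simply connected. -/
open scoped unitInterval

namespace CodimThree

section Homotopy

variable {X Y E : Type*} [TopologicalSpace X] [TopologicalSpace Y]
  [NormedAddCommGroup E] [NormedSpace ℝ E]

/-- The straight-line homotopy between two maps into a set containing all the segments joining
their values. -/
noncomputable def affineHomotopy {U : Set E} (f g : C(X, U))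
    (h : ∀ x, segment ℝ (f x : E) (g x) ⊆ U) : f.Homotopy g where
  toFun z := ⟨AffineMap.lineMap (f z.2 : E) (g z.2 : E) (z.1 : ℝ), h z.2 <| by
    rw [segment_eq_image_lineMap]
    exact ⟨z.1, z.1.2, rfl⟩⟩
  continuous_toFun := by
    simp only [AffineMap.lineMap_apply]
    fun_prop
  map_zero_left x := by simp
  map_one_left x := by simp

lemma affineHomotopy_congr {U : Set E} (f g : C(X, U))
    (h : ∀ x, segment ℝ (f x : E) (g x) ⊆ U) {x y : X} (hf : f x = f y) (hg : g x = g y)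
    (t : I) : affineHomotopy f g h (t, x) = affineHomotopy f g h (t, y) :=
  Subtype.ext <| by
    change AffineMap.lineMap (f x : E) (g x : E) (t : ℝ) = AffineMap.lineMap (f y : E) (g y : E) _
    rw [hf, hg]

lemma homotopic_refl_of_trans_homotopic {a b x c : Y} (ha : x = a) (hb : x = b)
    (q : Path a b) (e₁ : Path b c) (e₀ : Path a c)
    (h : (q.trans e₁).Homotopic (e₀.trans (Path.refl c)))
    (he : ∀ t, e₁ t = e₀ t) : (q.cast ha hb).Homotopic (Path.refl x) := by
  subst ha hb
  obtain rfl : e₁ = e₀ := Path.ext (funext he)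
  change q.Homotopic (Path.refl x)
  rw [← Path.Homotopic.Quotient.eq] at h ⊢
  simp only [Path.Homotopic.Quotient.mk_trans, Path.Homotopic.Quotient.mk_refl] at h ⊢
  set Q := Path.Homotopic.Quotient.mk q
  set e := Path.Homotopic.Quotient.mk e₁
  calc Q = (Q.trans e).trans e.symm := by simp
    _ = Path.Homotopic.Quotient.refl x := by rw [h]; simp

/-- A loop that is homotopic to a constant map through loops is null-homotopic. -/
lemma homotopic_refl_of_homotopy_const {x c : Y} (γ : Path x x)
    (F : γ.toContinuousMap.Homotopy (ContinuousMap.const I c))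
    (hF : ∀ t, F (t, 0) = F (t, 1)) : γ.Homotopic (Path.refl x) :=
  homotopic_refl_of_trans_homotopic γ.source.symm γ.target.symm
    (unitInterval.path01.map γ.continuous) (F.evalAt 1) (F.evalAt 0)
    (Path.Homotopic.map_trans_evalAt F unitInterval.path01) fun t => (hF t).symm

end Homotopy

section Polygonal

variable {E : Type*} [NormedAddCommGroup E] [NormedSpace ℝ E]

/-- The piecewise linear interpolation, with nodes the multiples of `1 / N`, of a curve. -/
noncomputable def interpolation (γ : C(I, E)) (N : ℕ) : C(I, E) where
  toFun t := ∑ j ∈ Finset.range (N + 1), max 0 (1 - |N * (t : ℝ) - j|) •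
    γ (Set.projIcc 0 1 zero_le_one ((j : ℝ) / N))
  continuous_toFun := by fun_prop

lemma interpolation_apply (γ : C(I, E)) {N j : ℕ} (hj : j < N) {t : I}
    (h₁ : (j : ℝ) ≤ N * t) (h₂ : N * (t : ℝ) ≤ j + 1) :
    interpolation γ N t =
      (1 - (N * (t : ℝ) - j)) • γ (Set.projIcc 0 1 zero_le_one ((j : ℝ) / N)) +
      (N * (t : ℝ) - j) • γ (Set.projIcc 0 1 zero_le_one (((j + 1 : ℕ) : ℝ) / N)) := by
  change ∑ i ∈ Finset.range (N + 1), _ = _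
  rw [Finset.sum_eq_add j (j + 1) (by omega)]
  · congr 2
    · rw [abs_of_nonneg (by linarith), max_eq_right (by linarith)]
    · push_cast
      rw [abs_of_nonpos (by linarith), max_eq_right (by linarith)]
      ring
  · rintro i - ⟨hij, hij'⟩
    rw [max_eq_left, zero_smul]
    rcases lt_or_gt_of_ne hij with h | h
    · have : (i : ℝ) + 1 ≤ j := by exact_mod_cast h
      linarith [le_abs_self (N * (t : ℝ) - i)]
    · have : (j : ℝ) + 1 + 1 ≤ i := by
        exact_mod_cast (by omega : j + 1 + 1 ≤ i)
      linarith [neg_le_abs (N * (t : ℝ) - i)]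
  · intro h
    exact absurd (Finset.mem_range.2 (by omega)) h
  · intro h
    exact absurd (Finset.mem_range.2 (by omega)) h

/-- Every curve is uniformly approximated by polygonal curves with the same endpoints. -/
lemma exists_polygonal_approximation (γ : C(I, E)) {ε : ℝ} (hε : 0 < ε) :
    ∃ (g : C(I, E)) (N : ℕ) (a b : Fin N → E), g 0 = γ 0 ∧ g 1 = γ 1 ∧
      (∀ t, dist (g t) (γ t) < ε) ∧ ∀ t, ∃ k, g t ∈ segment ℝ (a k) (b k) := by
  obtain ⟨δ, hδ, hγ⟩ := Metric.uniformContinuous_iff.1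
    (CompactSpace.uniformContinuous_of_continuous γ.continuous) ε hε
  obtain ⟨n, hn⟩ := exists_nat_one_div_lt hδ
  obtain ⟨N, hN⟩ : ∃ N, N = n + 1 := ⟨_, rfl⟩
  have hN0 : (0 : ℝ) < N := by rw [hN]; positivity
  have hNδ : 1 / (N : ℝ) < δ := by rw [hN]; exact_mod_cast hn
  set node : ℕ → E := fun j => γ (Set.projIcc 0 1 zero_le_one ((j : ℝ) / N)) with hnode
  have hex (t : I) : ∃ j < N, (j : ℝ) ≤ N * t ∧ N * (t : ℝ) ≤ j + 1 := by
    have ht0 : 0 ≤ N * (t : ℝ) := mul_nonneg hN0.le t.2.1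
    rcases lt_or_ge ⌊N * (t : ℝ)⌋₊ N with h | h
    · exact ⟨_, h, Nat.floor_le ht0, (Nat.lt_floor_add_one _).le⟩
    · have h1 : (N : ℝ) ≤ N * t := (Nat.le_floor_iff ht0).1 h
      have h2 : N * (t : ℝ) ≤ N := mul_le_of_le_one_right hN0.le t.2.2
      refine ⟨n, by omega, ?_, ?_⟩ <;> rw [hN] at * <;> push_cast at * <;> linarith
  have hdist {t : I} {j : ℕ} (hj : j ≤ N) (h : |N * (t : ℝ) - j| ≤ 1) :
      node j ∈ Metric.ball (γ t) ε := by
    refine hγ ?_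
    have hmem : (j : ℝ) / N ∈ Set.Icc (0 : ℝ) 1 :=
      ⟨by positivity, (div_le_one hN0).2 (by exact_mod_cast hj)⟩
    rw [Set.projIcc_of_mem _ hmem, dist_comm, Subtype.dist_eq, Real.dist_eq]
    have : (t : ℝ) - j / N = (N * t - j) / N := by field_simp
    change |(t : ℝ) - j / N| < δ
    rw [this, abs_div, abs_of_pos hN0]
    exact (div_le_div_of_nonneg_right h hN0.le).trans_lt hNδ
  have hseg {t : I} {j : ℕ} (hj : j < N) (h₁ : (j : ℝ) ≤ N * t) (h₂ : N * (t : ℝ) ≤ j + 1) :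
      interpolation γ N t ∈ segment ℝ (node j) (node (j + 1)) :=
    ⟨_, _, by linarith, by linarith, by ring, (interpolation_apply γ hj h₁ h₂).symm⟩
  refine ⟨interpolation γ N, N, fun k => node k, fun k => node (k + 1), ?_, ?_, fun t => ?_,
    fun t => ?_⟩
  · rw [interpolation_apply γ (j := 0) (by omega) (by simp) (by simp)]
    simp
  · rw [interpolation_apply γ (j := n) (by omega) (by simp [hN]) (by simp [hN]), ← hN,
      div_self hN0.ne']
    simp [hN]
  · obtain ⟨j, hj, h₁, h₂⟩ := hex t
    refine (convex_ball (γ t) ε).segment_subset (hdist hj.le ?_) (hdist hj ?_) (hseg hj h₁ h₂)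
    · rw [abs_le]; constructor <;> linarith
    · push_cast; rw [abs_le]; constructor <;> linarith
  · obtain ⟨j, hj, h₁, h₂⟩ := hex t
    exact ⟨⟨j, hj⟩, hseg hj h₁ h₂⟩

end Polygonal

section Cone

variable {V : Type*} [NormedAddCommGroup V] [NormedSpace ℝ V]

lemma segment_subset_compl_of_notMem_sup_span {W : Submodule ℝ V} {a b p q : V}
    (hp : p ∉ W ⊔ Submodule.span ℝ {a, b}) (hq : q ∈ segment ℝ a b) (hqW : q ∉ W) :
    segment ℝ q p ⊆ (W : Set V)ᶜ := by
  rintro _ ⟨s, t, -, -, hst, rfl⟩ hmem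
  rcases eq_or_ne t 0 with rfl | ht
  · obtain rfl : s = 1 := by linarith
    exact hqW (by simpa using hmem)
  · have hqs : q ∈ Submodule.span ℝ {a, b} := by
      obtain ⟨u, v, -, -, -, rfl⟩ := hq
      exact Submodule.mem_span_pair.2 ⟨u, v, rfl⟩
    have htp : t • p ∈ W ⊔ Submodule.span ℝ {a, b} := by
      have := Submodule.sub_mem _ (Submodule.mem_sup_left (T := Submodule.span ℝ {a, b}) hmem)
        (Submodule.mem_sup_right (S := W) (Submodule.smul_mem _ s hqs))
      simpa using this
    exact hp ((Submodule.smul_mem_iff _ ht).1 htp)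

variable [FiniteDimensional ℝ V]

lemma sup_span_pair_ne_top {W : Submodule ℝ V}
    (hW : Module.finrank ℝ W + 3 ≤ Module.finrank ℝ V) (a b : V) :
    W ⊔ Submodule.span ℝ {a, b} ≠ ⊤ := by
  classical
  intro h
  have h₁ := Submodule.finrank_add_le_finrank_add_finrank W (Submodule.span ℝ {a, b})
  have h₂ : Module.finrank ℝ (Submodule.span ℝ {a, b}) ≤ 2 := by
    have := finrank_span_finset_le_card (R := ℝ) ({a, b} : Finset V)
    rw [Finset.coe_pair] at this
    exact this.trans Finset.card_le_two
  rw [h, finrank_top] at h₁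
  omega

/-- Finitely many segments can be coned off, from a common apex, in the complement of finitely
many subspaces of codimension at least three. -/
lemma exists_cone_apex {ι κ : Type*} [Finite ι] [Finite κ] {W : ι → Submodule ℝ V}
    (hW : ∀ i, Module.finrank ℝ (W i) + 3 ≤ Module.finrank ℝ V) (a b : κ → V) :
    ∃ p ∈ Set.univ \ ⋃ i, (W i : Set V), ∀ k, ∀ q ∈ segment ℝ (a k) (b k),
      q ∈ Set.univ \ ⋃ i, (W i : Set V) →
        segment ℝ q p ⊆ Set.univ \ ⋃ i, (W i : Set V) := by
  have : ∃ p, ∀ z : ι × Option κ, p ∉ W z.1 ⊔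
      Submodule.span ℝ {z.2.elim 0 a, z.2.elim 0 b} := by
    by_contra! h
    obtain ⟨z, hz⟩ := Subspace.exists_eq_top_of_iUnion_eq_univ (k := ℝ)
      (p := fun z : ι × Option κ => W z.1 ⊔ Submodule.span ℝ {z.2.elim 0 a, z.2.elim 0 b})
      (Set.eq_univ_of_forall fun p => Set.mem_iUnion.2 (h p))
    exact sup_span_pair_ne_top (hW z.1) _ _ hz
  obtain ⟨p, hp⟩ := this
  refine ⟨p, ?_, fun k q hq hqU x hx => ?_⟩
  · simp only [Set.mem_sdiff, Set.mem_univ, Set.mem_iUnion, true_and, not_exists]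
    exact fun i hi => hp (i, none) (Submodule.mem_sup_left hi)
  · simp only [Set.mem_sdiff, Set.mem_univ, Set.mem_iUnion, true_and, not_exists] at hqU ⊢
    exact fun i => segment_subset_compl_of_notMem_sup_span (hp (i, some k)) hq (hqU i) hx

end Cone

end CodimThree

open CodimThree in
/-- The complement in a finite-dimensional real normed vector space `V` of a finite union of
linear subspaces of codimension at least 3 is nonempty, path-connected and simply connected. -/
theorem complement_of_union_of_codim_three_subspaces_simplyConnected
    {V : Type*} [NormedAddCommGroup V] [NormedSpace ℝ V] [FiniteDimensional ℝ V]
    (m : ℕ) (W : Fin m → Submodule ℝ V)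
    (hW : ∀ i, Module.finrank ℝ ↥(W i) + 3 ≤ Module.finrank ℝ V) :
    (Set.univ \ ⋃ i, ((W i : Set V))).Nonempty ∧
      IsPathConnected (Set.univ \ ⋃ i, ((W i : Set V))) ∧
      SimplyConnectedSpace ↥(Set.univ \ ⋃ i, ((W i : Set V))) := by
  have hcone {N : ℕ} (a b : Fin N → V) := exists_cone_apex hW a b
  have hopen : IsOpen (Set.univ \ ⋃ i, (W i : Set V)) :=
    isOpen_univ.sdiff (isClosed_iUnion_of_finite fun i => (W i).closed_of_finiteDimensional)
  generalize Set.univ \ ⋃ i, (W i : Set V) = U at hcone hopen ⊢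
  have hne : U.Nonempty := by
    obtain ⟨p, hp, -⟩ := hcone (N := 0) Fin.elim0 Fin.elim0
    exact ⟨p, hp⟩
  have hpath : IsPathConnected U := by
    refine isPathConnected_iff.2 ⟨hne, fun x hx y hy => ?_⟩
    obtain ⟨p, -, h⟩ := hcone ![x, y] ![x, y]
    exact (JoinedIn.of_segment_subset (h 0 x (left_mem_segment ..) hx)).trans
      (JoinedIn.of_segment_subset (h 1 y (left_mem_segment ..) hy)).symm
  refine ⟨hne, hpath, simply_connected_iff_loops_nullhomotopic.2
    ⟨isPathConnected_iff_pathConnectedSpace.1 hpath, fun x γ => ?_⟩⟩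
  let γ' : C(I, V) := ⟨fun t => γ t, by fun_prop⟩
  obtain ⟨ε, hε, hεU⟩ := (isCompact_range γ'.continuous).exists_thickening_subset_open hopen
    (Set.range_subset_iff.2 fun t => (γ t).2)
  obtain ⟨g, N, a, b, hg0, hg1, hgγ, hseg⟩ := exists_polygonal_approximation γ' hε
  have hball (t : I) : Metric.ball (γ' t) ε ⊆ U :=
    (Metric.ball_subset_thickening (Set.mem_range_self t) ε).trans hεU
  obtain ⟨p, hp, h⟩ := hcone a b
  let gU : C(I, U) := ⟨fun t => ⟨g t, hball t (hgγ t)⟩, by fun_prop⟩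
  let F := affineHomotopy γ.toContinuousMap gU fun t =>
    ((convex_ball (γ' t) ε).segment_subset (Metric.mem_ball_self hε) (hgγ t)).trans (hball t)
  let G := affineHomotopy gU (ContinuousMap.const I ⟨p, hp⟩) fun t => by
    obtain ⟨k, hk⟩ := hseg t
    exact h k (g t) hk (gU t).2
  have hγ : γ.toContinuousMap 0 = γ.toContinuousMap 1 := γ.source.trans γ.target.symm
  have hg : gU 0 = gU 1 := Subtype.ext <| hg0.trans <| (congrArg Subtype.val hγ).trans hg1.symm
  refine homotopic_refl_of_homotopy_const γ (F.trans G) fun t => ?_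
  rw [ContinuousMap.Homotopy.trans_apply, ContinuousMap.Homotopy.trans_apply]
  split_ifs
  · exact affineHomotopy_congr _ _ _ hγ hg _
  · exact affineHomotopy_congr _ _ _ hg rfl _
end

section
/- Let n ≥ 1 and let k : Fin n → ℕ with k i ≥ 1 for all i, and let d be the greatest common divisor of the k i. Let χ be the continuous group homomorphism from the torus 𝕋^n = (Fin n → Circle) to Circle given by χ(ζ) = ∏_i (ζ i)^(k i). Then the kernel of χ is isomorphic, as a topological group, to (Fin (n−1) → Circle) × Multiplicative (ZMod d). (In the paper: G_λ = {(ζ_1,…,ζ_n) ∈ 𝕋^n : ∏ ζ_j^{k_j} = 1} satisfies G_λ ≅ 𝕋^{n−1} × ℤ_d.) -/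
/-- The character `χ : 𝕋^n → Circle`, `χ(ζ) = ∏ i, (ζ i) ^ (k i)`, on the `n`-torus. -/
noncomputable def torusChar (n : ℕ) (k : Fin n → ℕ) : ((Fin n → Circle)) →* Circle where
  toFun ζ := ∏ i, ζ i ^ k i
  map_one' := by simp
  map_mul' := by
    intro x y
    simp [Pi.mul_apply, mul_pow, Finset.prod_mul_distrib]

/-- The automorphism of `G × G` given by the integer matrix with rows `(u, -b)` and `(v, a)` of
determinant one. -/
def unimodularMulEquiv (G : Type*) [CommGroup G] {a b u v : ℤ} (h : a * u + b * v = 1) :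
    G × G ≃* G × G where
  toFun q := (q.1 ^ u * q.2 ^ (-b), q.1 ^ v * q.2 ^ a)
  invFun q := (q.1 ^ a * q.2 ^ b, q.1 ^ (-v) * q.2 ^ u)
  left_inv q := by
    have key (x y : Additive G) :
        a • (u • x + (-b) • y) + b • (v • x + a • y) = x ∧
          (-v) • (u • x + (-b) • y) + u • (v • x + a • y) = y :=
      ⟨by linear_combination (norm := module) h • x, by linear_combination (norm := module) h • y⟩
    exact Prod.ext (key (.ofMul q.1) (.ofMul q.2)).1 (key (.ofMul q.1) (.ofMul q.2)).2
  right_inv q := by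
    have key (x y : Additive G) :
        u • (a • x + b • y) + (-b) • ((-v) • x + u • y) = x ∧
          v • (a • x + b • y) + a • ((-v) • x + u • y) = y :=
      ⟨by linear_combination (norm := module) h • x, by linear_combination (norm := module) h • y⟩
    exact Prod.ext (key (.ofMul q.1) (.ofMul q.2)).1 (key (.ofMul q.1) (.ofMul q.2)).2
  map_mul' x y := by
    ext <;> simp only [Prod.fst_mul, Prod.snd_mul, mul_zpow] <;> exact mul_mul_mul_comm _ _ _ _

/-- A product of powers on `G × G` becomes, after a change of coordinates, the power of the first
coordinate by the gcd of the exponents. -/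
theorem exists_mulEquiv_pow_mul_pow_eq_pow_gcd (G : Type*) [CommGroup G] [TopologicalSpace G]
    [IsTopologicalGroup G] (m n : ℕ) (hm : 0 < m) :
    ∃ e : G × G ≃* G × G, Continuous e ∧ ∀ q, (e q).1 ^ m * (e q).2 ^ n = q.1 ^ m.gcd n := by
  obtain ⟨a, ha⟩ := m.gcd_dvd_left n
  obtain ⟨b, hb⟩ := m.gcd_dvd_right n
  have hg : (m.gcd n : ℤ) ≠ 0 := by exact_mod_cast (Nat.gcd_pos_of_pos_left n hm).ne'
  have h : (a : ℤ) * m.gcdA n + b * m.gcdB n = 1 := by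
    apply mul_left_cancel₀ hg
    have hma : (m : ℤ) = m.gcd n * a := by exact_mod_cast ha
    have hnb : (n : ℤ) = m.gcd n * b := by exact_mod_cast hb
    linear_combination -Nat.gcd_eq_gcd_ab m n - m.gcdA n * hma - m.gcdB n * hnb
  refine ⟨unimodularMulEquiv G h, ?_, fun q => ?_⟩
  · change Continuous fun q : G × G => (q.1 ^ _ * q.2 ^ _, q.1 ^ _ * q.2 ^ _)
    fun_prop
  · have hq := congrArg Prod.fst ((unimodularMulEquiv G h).symm_apply_apply q)
    change (unimodularMulEquiv G h q).1 ^ (a : ℤ) * (unimodularMulEquiv G h q).2 ^ (b : ℤ) = q.1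
      at hq
    rw [zpow_natCast, zpow_natCast] at hq
    generalize unimodularMulEquiv G h q = r at hq ⊢
    rw [← hq, mul_pow, ← pow_mul, ← pow_mul, mul_comm a, mul_comm b, ← ha, ← hb]

theorem torusChar_succ (n : ℕ) (k : Fin (n + 1) → ℕ) (ζ : Fin (n + 1) → Circle) :
    torusChar (n + 1) k ζ = ζ 0 ^ k 0 * torusChar n (Fin.tail k) (Fin.tail ζ) :=
  Fin.prod_univ_succ _

theorem continuous_torusChar (n : ℕ) (k : Fin n → ℕ) : Continuous (torusChar n k) := by
  change Continuous fun ζ : Fin n → Circle => ∏ i, ζ i ^ k i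
  fun_prop

theorem univ_gcd_succ (n : ℕ) (k : Fin (n + 1) → ℕ) :
    Finset.univ.gcd k = (k 0).gcd (Finset.univ.gcd (Fin.tail k)) := by
  classical
  rw [Fin.univ_succ, Finset.cons_eq_insert, Finset.gcd_insert, Finset.map_eq_image,
    Finset.gcd_image]
  rfl

/-- After a continuous change of coordinates, a character of the torus is a power of the first
coordinate. -/
theorem exists_mulEquiv_torusChar_eq_pow_gcd (n : ℕ) (k : Fin (n + 1) → ℕ) (hk : ∀ i, 0 < k i) :
    ∃ e : Circle × (Fin n → Circle) ≃* (Fin (n + 1) → Circle), Continuous e ∧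
      ∀ q, torusChar (n + 1) k (e q) = q.1 ^ Finset.univ.gcd k := by
  induction n with
  | zero =>
    refine ⟨⟨⟨fun q _ => q.1, fun ζ => (ζ 0, 1), fun q => ?_, fun ζ => ?_⟩, fun _ _ => rfl⟩,
      ?_, fun q => ?_⟩
    · exact Prod.ext rfl (Subsingleton.elim _ _)
    · funext i
      exact congrArg ζ (Fin.fin_one_eq_zero i).symm
    · change Continuous fun (q : Circle × (Fin 0 → Circle)) (_ : Fin 1) => q.1
      fun_prop
    · simp [torusChar]
  | succ n ih =>
    obtain ⟨e, he, hχ⟩ := ih (Fin.tail k) fun i => hk i.succ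
    obtain ⟨f, hf, hfχ⟩ := exists_mulEquiv_pow_mul_pow_eq_pow_gcd Circle (k 0)
      (Finset.univ.gcd (Fin.tail k)) (hk 0)
    refine ⟨⟨⟨fun q => Fin.cons (f (q.1, q.2 0)).1 (e ((f (q.1, q.2 0)).2, Fin.tail q.2)),
      fun ζ => ((f.symm (ζ 0, (e.symm (Fin.tail ζ)).1)).1,
        Fin.cons (f.symm (ζ 0, (e.symm (Fin.tail ζ)).1)).2 (e.symm (Fin.tail ζ)).2),
      fun q => ?_, fun ζ => ?_⟩, fun p q => ?_⟩, ?_, fun q => ?_⟩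
    · simp
    · simp
    · have h0 : f ((p * q).1, (p * q).2 0) = f (p.1, p.2 0) * f (q.1, q.2 0) :=
        map_mul f (p.1, p.2 0) (q.1, q.2 0)
      have h1 : e ((f ((p * q).1, (p * q).2 0)).2, Fin.tail (p * q).2) =
          e ((f (p.1, p.2 0)).2, Fin.tail p.2) * e ((f (q.1, q.2 0)).2, Fin.tail q.2) := by
        rw [h0, ← map_mul e]
        rfl
      funext i
      refine Fin.cases ?_ (fun j => ?_) i
      · exact congrArg Prod.fst h0
      · exact congrFun h1 j
    · change Continuous fun q : Circle × (Fin (n + 1) → Circle) =>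
        (Fin.cons (f (q.1, q.2 0)).1 (e ((f (q.1, q.2 0)).2, Fin.tail q.2)) :
          Fin (n + 2) → Circle)
      have htail : Continuous fun q : Circle × (Fin (n + 1) → Circle) => Fin.tail q.2 := by
        unfold Fin.tail
        fun_prop
      fun_prop
    · rw [torusChar_succ, univ_gcd_succ, ← hfχ (q.1, q.2 0)]
      exact congrArg _ (hχ _)

/-- The `d`-th roots of unity in the circle are the values of `ZMod.toCircle`. -/
theorem exists_toCircle_eq_of_pow_eq_one {d : ℕ} [NeZero d] {z : Circle} (hz : z ^ d = 1) :
    ∃ j : ZMod d, ZMod.toCircle j = z := by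
  obtain ⟨j, hj⟩ := (bijective_rootsOfUnityAddChar d).2
    ⟨toUnits z, by ext; simp [hz]⟩
  exact ⟨j, by rw [← ZMod.rootsOfUnityAddChar_val, hj]; rfl⟩

/-- For positive integers `k 1, …, k n` with gcd `d`, the kernel of the continuous character
`χ(ζ) = ∏ ζ_i^{k_i}` on the torus `𝕋^n` is isomorphic, as a topological group, to
`𝕋^{n-1} × ℤ_d`. -/
theorem ker_torusChar_iso (n : ℕ) (hn : 1 ≤ n) (k : Fin n → ℕ) (hk : ∀ i, 1 ≤ k i)
    (d : ℕ) (hd : d = Finset.univ.gcd k) :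
    Continuous (torusChar n k) ∧
      ∃ e : ↥(torusChar n k).ker ≃* ((Fin (n - 1) → Circle) × Multiplicative (ZMod d)),
        Continuous e ∧ Continuous e.symm := by
  refine ⟨continuous_torusChar n k, ?_⟩
  obtain ⟨m, rfl⟩ : ∃ m, n = m + 1 := ⟨n - 1, by omega⟩
  have : NeZero d := ⟨fun h => (Nat.pos_iff_ne_zero.1 (hk 0)) <|
    Finset.gcd_eq_zero_iff.1 (hd.symm.trans h) 0 (Finset.mem_univ _)⟩
  obtain ⟨e, he, hχ⟩ := exists_mulEquiv_torusChar_eq_pow_gcd m k hk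
  rw [← hd] at hχ
  let g : (Fin m → Circle) × Multiplicative (ZMod d) →* Circle × (Fin m → Circle) :=
    (ZMod.toCircle.toMonoidHom.comp (.snd _ _)).prod (.fst _ _)
  have hg : Continuous g := by
    have : Continuous (ZMod.toCircle.toMonoidHom : Multiplicative (ZMod d) → Circle) :=
      continuous_bot
    exact (this.comp continuous_snd).prodMk continuous_fst
  have hker (p) : e (g p) ∈ (torusChar (m + 1) k).ker := by
    rw [MonoidHom.mem_ker, hχ]
    change ZMod.toCircle p.2.toAdd ^ d = 1
    simp [← AddChar.map_nsmul_eq_pow]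
  let f : (Fin m → Circle) × Multiplicative (ZMod d) →* (torusChar (m + 1) k).ker :=
    (e.toMonoidHom.comp g).codRestrict _ hker
  have hf : Continuous f := (he.comp hg).subtype_mk hker
  have hbij : Function.Bijective f := by
    constructor
    · intro p q hpq
      have h : g p = g q := e.injective (congrArg Subtype.val hpq)
      exact Prod.ext (congrArg Prod.snd h) (ZMod.injective_toCircle (congrArg Prod.fst h))
    · rintro ⟨ζ, hζ⟩
      obtain ⟨q, rfl⟩ := e.surjective ζ
      rw [MonoidHom.mem_ker, hχ] at hζ
      obtain ⟨j, hj⟩ := exists_toCircle_eq_of_pow_eq_one hζ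
      exact ⟨(q.2, .ofAdd j), Subtype.ext (congrArg e (Prod.ext hj rfl))⟩
  have : CompactSpace (Multiplicative (ZMod d)) := inferInstanceAs (CompactSpace (ZMod d))
  let E := MulEquiv.ofBijective f hbij
  have hE : Continuous E.toEquiv := hf
  exact ⟨E.symm, hE.continuous_symm_of_equiv_compact_to_t2, hf⟩
end

section
/- Let k ≥ 1 and let λ ≤ μ ≤ ν be equivalence relations (Setoids) on Fin k in the refinement order (λ finest). Let Σ_{λμν} be the subgroup of Perm (Fin k) of permutations preserving each of λ, μ, ν (σ preserves κ iff ∀ i j, i ∼_κ j ↔ σ i ∼_κ σ j), let Σ_{λμ} be the subgroup of permutations preserving λ and μ, and for a Setoid κ let P_κ = {σ : ∀ i, σ i ∼_κ i}. Then: (a) P_μ ∩ Σ_{λμ} = P_μ ∩ Σ_{λμν}; (b) P_λ and P_μ ∩ Σ_{λμν} are normal subgroups of P_ν ∩ Σ_{λμν} with P_λ ⊆ P_μ ∩ Σ_{λμν}; and (c) the natural quotient map from G := (P_ν ∩ Σ_{λμν}) / P_λ onto G' := (P_ν ∩ Σ_{λμν}) / (P_μ ∩ Σ_{λμν}) is a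 surjective group homomorphism whose kernel is isomorphic to Sym⁰_{λμ} := (P_μ ∩ Σ_{λμ}) / P_λ. (This is the exactness statement identifying the two descriptions of the corner ∂_μ N_{λν} = ∂_λ N_{μν}.) -/
/-- The subgroup of permutations of `Fin k` preserving the setoid `s`:
`σ` with `i ∼ j ↔ σ i ∼ σ j` for all `i, j`. -/
def presGrp {k : ℕ} (s : Setoid (Fin k)) : Subgroup (Equiv.Perm (Fin k)) where
  carrier := {σ | ∀ i j, s i j ↔ s (σ i) (σ j)}
  one_mem' := fun _ _ => Iff.rfl
  mul_mem' := by
    intro a b ha hb i j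
    exact (hb i j).trans (ha (b i) (b j))
  inv_mem' := by
    intro a ha i j
    simpa using (ha (a⁻¹ i) (a⁻¹ j)).symm

theorem ptwGrp_mono {k : ℕ} {s t : Setoid (Fin k)} (h : s ≤ t) : ptwGrp s ≤ ptwGrp t :=
  fun _ hσ i => h (hσ i)

theorem ptwGrp_le_presGrp {k : ℕ} (s : Setoid (Fin k)) : ptwGrp s ≤ presGrp s :=
  fun _ hσ i j =>
    ⟨fun h => s.trans (hσ i) (s.trans h (s.symm (hσ j))),
      fun h => s.trans (s.symm (hσ i)) (s.trans h (hσ j))⟩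

theorem conj_mem_ptwGrp {k : ℕ} {s : Setoid (Fin k)} {σ τ : Equiv.Perm (Fin k)}
    (hσ : σ ∈ presGrp s) (hτ : τ ∈ ptwGrp s) : σ * τ * σ⁻¹ ∈ ptwGrp s := by
  intro i
  have h := (hσ _ _).1 (hτ (σ⁻¹ i))
  simpa using h

/-- The third isomorphism theorem for subgroups `N ≤ M ≤ H`: the natural map `H/N → H/M` is
surjective with kernel isomorphic to `M/N`. -/
theorem exists_quotient_map_ker_equiv {G : Type*} [Group G] {N M H : Subgroup G}
    (hNM : N ≤ M) (hMH : M ≤ H) [(N.subgroupOf H).Normal] [(M.subgroupOf H).Normal]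
    [(N.subgroupOf M).Normal] :
    ∃ f : (H ⧸ N.subgroupOf H) →* (H ⧸ M.subgroupOf H),
      Function.Surjective f ∧ (∀ σ : H, f (QuotientGroup.mk σ) = QuotientGroup.mk σ) ∧
        Nonempty (f.ker ≃* (M ⧸ N.subgroupOf M)) := by
  let f : (H ⧸ N.subgroupOf H) →* (H ⧸ M.subgroupOf H) :=
    QuotientGroup.map _ _ (MonoidHom.id H) fun _ hx => hNM hx
  have hf : ∀ σ : H, f (QuotientGroup.mk σ) = QuotientGroup.mk σ := fun _ => rfl
  refine ⟨f, fun y => ?_, hf, ?_⟩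
  · obtain ⟨σ, rfl⟩ := QuotientGroup.mk_surjective y
    exact ⟨QuotientGroup.mk σ, hf σ⟩
  · let g : M →* f.ker :=
      ((QuotientGroup.mk' (N.subgroupOf H)).comp (Subgroup.inclusion hMH)).codRestrict f.ker
        fun m => MonoidHom.mem_ker.2 <| (hf _).trans <| (QuotientGroup.eq_one_iff _).2 m.2
    have hker : N.subgroupOf M = g.ker := by
      ext m
      rw [MonoidHom.mem_ker, Subtype.ext_iff]
      exact (QuotientGroup.eq_one_iff (N := N.subgroupOf H) (Subgroup.inclusion hMH m)).symm
    have hg : Function.Surjective g := by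
      rintro ⟨y, hy⟩
      obtain ⟨σ, rfl⟩ := QuotientGroup.mk_surjective y
      have hσ : (σ : G) ∈ M := (QuotientGroup.eq_one_iff (N := M.subgroupOf H) σ).1 hy
      exact ⟨⟨σ, hσ⟩, rfl⟩
    exact ⟨((QuotientGroup.quotientMulEquivOfEq hker).trans
      (QuotientGroup.quotientKerEquivOfSurjective g hg)).symm⟩

/-- For a chain of set partitions `λ ≤ μ ≤ ν` of `Fin k`, with
`Σ_{λμν} = presGrp λ ⊓ presGrp μ ⊓ presGrp ν`, `Σ_{λμ} = presGrp λ ⊓ presGrp μ`: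
(a) `P_μ ⊓ Σ_{λμ} = P_μ ⊓ Σ_{λμν}`;
(b) `P_λ` and `P_μ ⊓ Σ_{λμν}` are normal in `H = P_ν ⊓ Σ_{λμν}` with `P_λ ⊆ P_μ ⊓ Σ_{λμν}`;
(c) the natural map `G = H/P_λ → G' = H/(P_μ ⊓ Σ_{λμν})` is a surjective homomorphism with
kernel isomorphic to `Sym⁰_{λμ} = (P_μ ⊓ Σ_{λμ})/P_λ`. -/
theorem corner_exact_sequence (k : ℕ) (hk : 1 ≤ k) (lam mu nu : Setoid (Fin k))
    (hlm : lam ≤ mu) (hmn : mu ≤ nu) :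
    (ptwGrp mu ⊓ (presGrp lam ⊓ presGrp mu) =
        ptwGrp mu ⊓ (presGrp lam ⊓ presGrp mu ⊓ presGrp nu)) ∧
    (ptwGrp lam ≤ ptwGrp mu ⊓ (presGrp lam ⊓ presGrp mu ⊓ presGrp nu)) ∧
    ((ptwGrp lam).subgroupOf
        (ptwGrp nu ⊓ (presGrp lam ⊓ presGrp mu ⊓ presGrp nu))).Normal ∧
    (((ptwGrp mu ⊓ (presGrp lam ⊓ presGrp mu ⊓ presGrp nu)).subgroupOf
        (ptwGrp nu ⊓ (presGrp lam ⊓ presGrp mu ⊓ presGrp nu)))).Normal ∧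
    (∀ [_h1 : ((ptwGrp lam).subgroupOf
          (ptwGrp nu ⊓ (presGrp lam ⊓ presGrp mu ⊓ presGrp nu))).Normal]
       [_h2 : (((ptwGrp mu ⊓ (presGrp lam ⊓ presGrp mu ⊓ presGrp nu)).subgroupOf
          (ptwGrp nu ⊓ (presGrp lam ⊓ presGrp mu ⊓ presGrp nu)))).Normal]
       [_h3 : ((ptwGrp lam).subgroupOf (ptwGrp mu ⊓ (presGrp lam ⊓ presGrp mu))).Normal],
      ∃ f : (↥(ptwGrp nu ⊓ (presGrp lam ⊓ presGrp mu ⊓ presGrp nu)) ⧸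
              (ptwGrp lam).subgroupOf
                (ptwGrp nu ⊓ (presGrp lam ⊓ presGrp mu ⊓ presGrp nu))) →*
            (↥(ptwGrp nu ⊓ (presGrp lam ⊓ presGrp mu ⊓ presGrp nu)) ⧸
              (ptwGrp mu ⊓ (presGrp lam ⊓ presGrp mu ⊓ presGrp nu)).subgroupOf
                (ptwGrp nu ⊓ (presGrp lam ⊓ presGrp mu ⊓ presGrp nu))),
        Function.Surjective f ∧
        (∀ σ : ↥(ptwGrp nu ⊓ (presGrp lam ⊓ presGrp mu ⊓ presGrp nu)),
          f (QuotientGroup.mk σ) = QuotientGroup.mk σ) ∧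
        Nonempty (↥f.ker ≃*
          (↥(ptwGrp mu ⊓ (presGrp lam ⊓ presGrp mu)) ⧸
            (ptwGrp lam).subgroupOf (ptwGrp mu ⊓ (presGrp lam ⊓ presGrp mu))))) := by
  have hM : ptwGrp mu ⊓ (presGrp lam ⊓ presGrp mu) =
      ptwGrp mu ⊓ (presGrp lam ⊓ presGrp mu ⊓ presGrp nu) :=
    le_antisymm
      (fun _ h => ⟨h.1, h.2, ptwGrp_le_presGrp nu (ptwGrp_mono hmn h.1)⟩)
      (fun _ h => ⟨h.1, h.2.1⟩)
  have hNM : ptwGrp lam ≤ ptwGrp mu ⊓ (presGrp lam ⊓ presGrp mu) := fun _ h =>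
    ⟨ptwGrp_mono hlm h, ptwGrp_le_presGrp lam h, ptwGrp_le_presGrp mu (ptwGrp_mono hlm h)⟩
  refine ⟨hM, hM ▸ hNM, ⟨fun τ hτ σ => conj_mem_ptwGrp σ.2.2.1.1 hτ⟩,
    ⟨fun τ hτ σ => ⟨conj_mem_ptwGrp σ.2.2.1.2 hτ.1, (σ * τ * σ⁻¹).2.2⟩⟩, ?_⟩
  rw [← hM]
  intro _ _ _
  exact exists_quotient_map_ker_equiv hNM
    (hM.le.trans (inf_le_inf_right _ (ptwGrp_mono hmn)))
end

section
/- For every natural number N there exists a constant C ≥ 1, depending only on N, with the following property: for every real R ≥ 1 and every finite set S of points in euclidean ℝ³ with cardinality at most N, there exist an integer n ≤ N, points p_1, …, p_n ∈ ℝ³ and a radius r with R ≤ r ≤ C·R, such that every point of S lies in one of the closed balls B(p_i, r), and the centers are widely separated: |p_i − p_j| > 2r for all i ≠ j (in particular the balls are pairwise disjoint). (This is the cluster-decomposition covering produced by the algorithm in the proof that the sets of decomposable monopoles cover the moduli space: the strong-field region is covered by finitely many widely separated balls whose radii come from a finite list depending only on the number of components.) -/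
/-- If `S` is covered by the balls of radius `r` centered at a finite set `T`, then some subset of
`T` is `2 r'`-separated and covers `S` by balls of radius `r'`, where `r ≤ r' ≤ 3 ^ #T * r`. -/
theorem exists_separated_subset_cover {X : Type*} [MetricSpace X] (S : Set X) (T : Finset X)
    (r : ℝ) (hr : 0 ≤ r) (hT : ∀ x ∈ S, ∃ y ∈ T, dist x y ≤ r) :
    ∃ U ⊆ T, ∃ r' : ℝ, r ≤ r' ∧ r' ≤ 3 ^ T.card * r ∧ (∀ x ∈ S, ∃ y ∈ U, dist x y ≤ r') ∧
      ∀ a ∈ U, ∀ b ∈ U, a ≠ b → 2 * r' < dist a b := by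
  classical
  induction T using Finset.strongInduction generalizing r with
  | H T ih =>
    by_cases hsep : ∀ a ∈ T, ∀ b ∈ T, a ≠ b → 2 * r < dist a b
    · exact ⟨T, subset_rfl, r, le_rfl,
        le_mul_of_one_le_left hr (one_le_pow₀ (by norm_num)), hT, hsep⟩
    · push Not at hsep
      obtain ⟨a, ha, b, hb, hab, hd⟩ := hsep
      obtain ⟨U, hU, r', h1, h2, h3, h4⟩ :=
        ih (T.erase b) (Finset.erase_ssubset hb) (3 * r) (by positivity) (by
          intro x hx
          obtain ⟨y, hy, hxy⟩ := hT x hx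
          by_cases hyb : y = b
          · subst hyb
            exact ⟨a, Finset.mem_erase.2 ⟨hab, ha⟩, by
              linarith [dist_triangle x y a, dist_comm a y]⟩
          · exact ⟨y, Finset.mem_erase.2 ⟨hyb, hy⟩, by linarith⟩)
      refine ⟨U, hU.trans (Finset.erase_subset _ _), r', by linarith, ?_, h3, h4⟩
      rw [← Finset.card_erase_add_one hb, pow_succ]
      linarith


/-- Cluster decomposition covering: for every `N` there is `C ≥ 1` (depending only on `N`)
such that for every `R ≥ 1` and every finite set `S ⊆ ℝ³` of at most `N` points, there are
`n ≤ N` centers `p 1, …, p n` and a radius `r` with `R ≤ r ≤ C·R` such that `S` is covered by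
the closed balls `B(p i, r)` and the centers are widely separated:
`|p i − p j| > 2r` for `i ≠ j` (so the balls are pairwise disjoint with a definite gap). -/
theorem exists_separated_cluster_cover (N : ℕ) :
    ∃ C : ℝ, 1 ≤ C ∧
      ∀ R : ℝ, 1 ≤ R →
        ∀ S : Finset (EuclideanSpace ℝ (Fin 3)), S.card ≤ N →
          ∃ (n : ℕ) (_ : n ≤ N) (p : Fin n → EuclideanSpace ℝ (Fin 3)) (r : ℝ),
            R ≤ r ∧ r ≤ C * R ∧
            (∀ x ∈ S, ∃ i, x ∈ Metric.closedBall (p i) r) ∧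
            (∀ i j, i ≠ j → 2 * r < dist (p i) (p j)) := by
  refine ⟨3 ^ N, one_le_pow₀ (by norm_num), fun R hR S hS => ?_⟩
  have hR0 : 0 ≤ R := zero_le_one.trans hR
  obtain ⟨U, hU, r, h1, h2, h3, h4⟩ := exists_separated_subset_cover (S : Set _) S R hR0
    fun x hx => ⟨x, hx, by simpa using hR0⟩
  refine ⟨U.card, (Finset.card_le_card hU).trans hS, fun i => (U.equivFin.symm i : _), r, h1,
    h2.trans ?_, fun x hx => ?_, fun i j hij => ?_⟩
  · gcongr
    norm_num
  · obtain ⟨y, hy, hxy⟩ := h3 x hx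
    exact ⟨U.equivFin ⟨y, hy⟩, by simpa using hxy⟩
  · exact h4 _ (U.equivFin.symm i).2 _ (U.equivFin.symm j).2 fun h =>
      hij (U.equivFin.symm.injective (Subtype.ext h))
end
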